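/- (One-dimensional characterization of existence of strongly positive Neumann solutions for some exponent.) Let L > 0 and let a : [0,L] → ℝ be continuous and change sign. Then there exists q ∈ (0,1) such that the Neumann problem (P_N) with weight a and exponent q has a strongly positive solution (u > 0 on all of [0,L]) if and only if ∫₀^L a(x) dx < 0. -/

import Mathlib

open Real Set

/-- `u` (with first and second derivatives `u'`, `u''`) is a solution of the
one-dimensional Neumann problem `(P_N)` on `[0, L]` with weight `a` and exponent `q`:
`u` is twice continuously differentiable on `[0, L]`, nonnegative, has vanishing
derivative at the endpoints, and satisfies `-u'' = a(x) u^q` on `[0, L]`. -/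
def NeumannSolution (L q : ℝ) (a u u' u'' : ℝ → ℝ) : Prop :=
  (∀ x ∈ Set.Icc (0 : ℝ) L, HasDerivWithinAt u (u' x) (Set.Icc 0 L) x) ∧
  (∀ x ∈ Set.Icc (0 : ℝ) L, HasDerivWithinAt u' (u'' x) (Set.Icc 0 L) x) ∧
  ContinuousOn u'' (Set.Icc 0 L) ∧
  (∀ x ∈ Set.Icc (0 : ℝ) L, 0 ≤ u x) ∧
  u' 0 = 0 ∧ u' L = 0 ∧
  (∀ x ∈ Set.Icc (0 : ℝ) L, -u'' x = a x * u x ^ q)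

/-- The weight `a` changes sign on `[0, L]`: it attains both positive and negative
values. -/
def ChangesSign (L : ℝ) (a : ℝ → ℝ) : Prop :=
  (∃ x ∈ Set.Icc (0 : ℝ) L, 0 < a x) ∧ (∃ x ∈ Set.Icc (0 : ℝ) L, a x < 0)

open Metric in
/-- A globally Lipschitz and bounded vector field has a flow on every compact time interval, which is
Lipschitz in the initial point on balls. -/
theorem exists_flow_of_lipschitzWith_of_norm_le {E : Type*} [NormedAddCommGroup E]
    [NormedSpace ℝ E] [CompleteSpace E] {f : ℝ → E → E} {T : ℝ} (hT : 0 ≤ T) {B K : NNReal}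
    (hlip : ∀ t ∈ Icc 0 T, LipschitzWith K (f t))
    (hcont : ∀ x, ContinuousOn (f · x) (Icc 0 T))
    (hB : ∀ t ∈ Icc 0 T, ∀ x, ‖f t x‖ ≤ B) (x₀ : E) (r : NNReal) :
    ∃ α : E → ℝ → E, (∀ x ∈ closedBall x₀ r, α x 0 = x ∧
      ∀ t ∈ Icc 0 T, HasDerivWithinAt (α x) (f t (α x t)) (Icc 0 T) t) ∧
      ∃ K' : NNReal, ∀ t ∈ Icc 0 T, LipschitzOnWith K' (α · t) (closedBall x₀ r) := by
  have h : IsPicardLindelof f (⟨0, le_rfl, hT⟩ : Icc 0 T) x₀ (B * T.toNNReal + r) r B K :=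
    { lipschitzOnWith := fun t ht => (hlip t ht).lipschitzOnWith
      continuousOn := fun x _ => hcont x
      norm_le := fun t ht x _ => hB t ht x
      mul_max_le := by
        rw [sub_zero, sub_zero, max_eq_left hT, NNReal.coe_add, NNReal.coe_mul,
          Real.coe_toNNReal _ hT, add_sub_cancel_right] }
  exact h.exists_forall_mem_closedBall_eq_hasDerivWithinAt_lipschitzOnWith

/-- The truncation of a real number to `[-M, M]`. -/
def clamp (M y : ℝ) : ℝ := max (-M) (min M y)

theorem abs_clamp_le {M : ℝ} (hM : 0 ≤ M) (y : ℝ) : |clamp M y| ≤ M :=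
  abs_le.2 ⟨le_max_left _ _, max_le (by linarith) (min_le_left _ _)⟩

theorem clamp_eq_self {M y : ℝ} (hy : |y| ≤ M) : clamp M y = y := by
  rw [clamp, min_eq_right (abs_le.1 hy).2, max_eq_right (abs_le.1 hy).1]

theorem abs_clamp_sub_clamp_le (M x y : ℝ) : |clamp M x - clamp M y| ≤ |x - y| := by
  simpa [Real.dist_eq, clamp] using
    ((LipschitzWith.id.const_min M).const_max (-M)).dist_le_mul x y

theorem abs_clamp_sq_div_max_sub_le {M δ : ℝ} (hM : 0 ≤ M) (hδ : 0 < δ) (z₁ z₂ p₁ p₂ : ℝ) :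
    |clamp M p₁ ^ 2 / max z₁ δ - clamp M p₂ ^ 2 / max z₂ δ| ≤
      2 * M / δ * |p₁ - p₂| + M ^ 2 / δ ^ 2 * |z₁ - z₂| := by
  have hm₁ : δ ≤ max z₁ δ := le_max_right _ _
  have hm₂ : δ ≤ max z₂ δ := le_max_right _ _
  have hmm : |max z₁ δ - max z₂ δ| ≤ |z₁ - z₂| := by
    simpa [Real.dist_eq] using (LipschitzWith.id.max_const δ).dist_le_mul z₁ z₂
  have hc := abs_clamp_sub_clamp_le M p₁ p₂
  have h₁ := abs_clamp_le hM p₁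
  have h₂ := abs_clamp_le hM p₂
  generalize max z₁ δ = m₁ at *
  generalize max z₂ δ = m₂ at *
  generalize clamp M p₁ = c₁ at *
  generalize clamp M p₂ = c₂ at *
  have hm₁0 : 0 < m₁ := hδ.trans_le hm₁
  have hm₂0 : 0 < m₂ := hδ.trans_le hm₂
  have e : c₁ ^ 2 / m₁ - c₂ ^ 2 / m₂ =
      (c₁ + c₂) / m₁ * (c₁ - c₂) + c₂ ^ 2 / (m₁ * m₂) * (m₂ - m₁) := by
    field_simp
    ring
  rw [e]
  refine (abs_add_le _ _).trans ?_
  rw [abs_mul, abs_mul, abs_div, abs_div, abs_mul, abs_of_pos hm₁0, abs_of_pos hm₂0, abs_pow,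
    abs_sub_comm m₂ m₁]
  have h₁₂ : |c₁ + c₂| ≤ 2 * M := (abs_add_le _ _).trans (by linarith)
  have hmul : δ ^ 2 ≤ m₁ * m₂ := by nlinarith
  gcongr

/-- The flow of the truncation of the system `z' = ε p`, `p' = -a - q p ^ 2 / z`, started at
`z = s`, `p = 0`. -/
theorem exists_truncated_flow {L : ℝ} (hL : 0 ≤ L) {a : ℝ → ℝ} (ha : ContinuousOn a (Icc 0 L))
    {M ε q δ : ℝ} (hM : 0 ≤ M) (hδ : 0 < δ) (s₀ s₁ : ℝ) :
    ∃ z p : ℝ → ℝ → ℝ, (∀ s ∈ Icc s₀ s₁, z s 0 = s ∧ p s 0 = 0 ∧ ∀ t ∈ Icc 0 L,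
      HasDerivWithinAt (z s) (ε * clamp M (p s t)) (Icc 0 L) t ∧
      HasDerivWithinAt (p s) (-a t - q * (clamp M (p s t) ^ 2 / max (z s t) δ)) (Icc 0 L) t) ∧
      ContinuousOn (fun s => p s L) (Icc s₀ s₁) := by
  rcases lt_or_ge s₁ s₀ with hs | hs
  · exact ⟨0, 0, by simp [Icc_eq_empty_of_lt hs], by simp [Icc_eq_empty_of_lt hs]⟩
  obtain ⟨A, hA⟩ := isCompact_Icc.exists_bound_of_continuousOn ha
  have hA0 : 0 ≤ A := (norm_nonneg _).trans (hA 0 ⟨le_rfl, hL⟩)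
  have hbd (z p : ℝ) : |clamp M p ^ 2 / max z δ| ≤ M ^ 2 / δ := by
    have hm : δ ≤ max z δ := le_max_right _ _
    rw [abs_div, abs_pow, abs_of_pos (hδ.trans_le hm)]
    gcongr
    exact abs_clamp_le hM p
  obtain ⟨α, hα, K', hK'⟩ := exists_flow_of_lipschitzWith_of_norm_le (E := ℝ × ℝ) hL
    (f := fun t x => (ε * clamp M x.2, -a t - q * (clamp M x.2 ^ 2 / max x.1 δ)))
    (B := (|ε| * M + (A + |q| * (M ^ 2 / δ))).toNNReal)
    (K := (|ε| + |q| * (2 * M / δ + M ^ 2 / δ ^ 2)).toNNReal)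
    (fun t _ => LipschitzWith.of_dist_le_mul fun x y => by
      have hx : |x.1 - y.1| ≤ dist x y := le_max_left _ _
      have hy : |x.2 - y.2| ≤ dist x y := le_max_right _ _
      rw [Real.coe_toNNReal _ (by positivity), Prod.dist_eq, Real.dist_eq, Real.dist_eq]
      have hd : 0 ≤ dist x y := dist_nonneg
      refine max_le ?_ ?_
      · rw [← mul_sub, abs_mul]
        calc |ε| * |clamp M x.2 - clamp M y.2| ≤ |ε| * dist x y := by
              gcongr
              exact (abs_clamp_sub_clamp_le _ _ _).trans hy
          _ ≤ _ := by
              gcongr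
              exact le_add_of_nonneg_right (by positivity)
      · rw [sub_sub_sub_cancel_left, ← mul_sub, abs_mul, abs_sub_comm]
        calc _ ≤ |q| * (2 * M / δ * |x.2 - y.2| + M ^ 2 / δ ^ 2 * |x.1 - y.1|) := by
              gcongr
              exact abs_clamp_sq_div_max_sub_le hM hδ _ _ _ _
          _ ≤ |q| * (2 * M / δ * dist x y + M ^ 2 / δ ^ 2 * dist x y) := by gcongr
          _ = (|q| * (2 * M / δ + M ^ 2 / δ ^ 2)) * dist x y := by ring
          _ ≤ _ := by
              gcongr
              exact le_add_of_nonneg_left (abs_nonneg _))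
    (fun x => continuousOn_const.prodMk (ha.neg.sub continuousOn_const))
    (fun t ht x => by
      rw [Real.coe_toNNReal _ (by positivity), Prod.norm_def]
      refine max_le ?_ ?_
      · rw [Real.norm_eq_abs, abs_mul]
        refine le_add_of_le_of_nonneg ?_ (by positivity)
        gcongr
        exact abs_clamp_le hM _
      · refine le_add_of_nonneg_of_le (by positivity) ((norm_sub_le _ _).trans ?_)
        rw [norm_neg, norm_mul]
        gcongr
        · exact hA t ht
        · exact le_rfl
        · exact hbd _ _)
    ((s₀ + s₁) / 2, 0) ((s₁ - s₀) / 2).toNNReal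
  have hball : ∀ s ∈ Icc s₀ s₁, ((s, 0) : ℝ × ℝ) ∈
      Metric.closedBall (((s₀ + s₁) / 2, 0) : ℝ × ℝ) ((s₁ - s₀) / 2).toNNReal := by
    intro s hs'
    rw [Real.coe_toNNReal _ (by linarith), Metric.mem_closedBall, Prod.dist_eq]
    refine max_le ?_ (by simp only [dist_self]; linarith)
    rw [Real.dist_eq, abs_le]
    constructor <;> linarith [hs'.1, hs'.2]
  refine ⟨fun s t => (α (s, 0) t).1, fun s t => (α (s, 0) t).2, fun s hs' => ?_, ?_⟩
  · obtain ⟨h0, hd⟩ := hα _ (hball s hs')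
    refine ⟨by simp [h0], by simp [h0], fun t ht => ⟨?_, ?_⟩⟩
    · exact hasFDerivAt_fst.comp_hasDerivWithinAt t (hd t ht)
    · exact hasFDerivAt_snd.comp_hasDerivWithinAt t (hd t ht)
  · exact continuous_snd.comp_continuousOn
      ((hK' L ⟨hL, le_rfl⟩).continuousOn.comp (by fun_prop) hball)

theorem sub_le_mul_sub_of_hasDerivWithinAt_le {f f' : ℝ → ℝ} {a b C : ℝ}
    (hf : ∀ x ∈ Icc a b, HasDerivWithinAt f (f' x) (Icc a b) x) (hC : ∀ x ∈ Icc a b, f' x ≤ C)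
    {x y : ℝ} (hx : x ∈ Icc a b) (hy : y ∈ Icc a b) (hxy : x ≤ y) :
    f y - f x ≤ C * (y - x) := by
  have h : AntitoneOn (fun t => f t - C * t) (Icc a b) := by
    refine antitoneOn_of_hasDerivWithinAt_nonpos (f' := fun t => f' t - C * 1) (convex_Icc a b)
      ?_ ?_ ?_
    · exact (HasDerivWithinAt.continuousOn hf).sub (by fun_prop)
    · intro t ht
      exact ((hf t (interior_subset ht)).mono interior_subset).sub
        ((hasDerivWithinAt_id t _).const_mul C)
    · intro t ht
      linarith [hC t (interior_subset ht)]
  have := h hx hy hxy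
  simp only at this
  linarith

/-- A solution of the Riccati differential inequality `p' ≤ -η (1 + (k p) ^ 2)` only exists on
short intervals. -/
theorem mul_length_lt_pi_of_riccati {p p' : ℝ → ℝ} {c d η k : ℝ} (hcd : c ≤ d) (hk : 0 ≤ k)
    (hp : ∀ x ∈ Icc c d, HasDerivWithinAt p (p' x) (Icc c d) x)
    (h : ∀ x ∈ Icc c d, p' x ≤ -(η * (1 + (k * p x) ^ 2))) : η * k * (d - c) < π := by
  have hθ := sub_le_mul_sub_of_hasDerivWithinAt_le (C := -(η * k))
    (fun x hx => ((hp x hx).const_mul k).arctan) (fun x hx => by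
      have := mul_le_mul_of_nonneg_left (h x hx) hk
      rw [one_div, inv_mul_le_iff₀ (by positivity)]
      linarith) (left_mem_Icc.2 hcd) (right_mem_Icc.2 hcd) hcd
  have h₁ := arctan_lt_pi_div_two (k * p c)
  have h₂ := neg_pi_div_two_lt_arctan (k * p d)
  linarith

theorem exists_Icc_le_of_pos {L : ℝ} (hL : 0 < L) {a : ℝ → ℝ} (ha : ContinuousOn a (Icc 0 L))
    {x : ℝ} (hx : x ∈ Icc 0 L) (hax : 0 < a x) :
    ∃ c d η : ℝ, c < d ∧ 0 < η ∧ Icc c d ⊆ Icc 0 L ∧ ∀ t ∈ Icc c d, η ≤ a t := by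
  obtain ⟨r, hr, hra⟩ := Metric.continuousWithinAt_iff.1 (ha x hx) (a x / 2) (by linarith)
  have hsub : Icc (max 0 (x - r / 2)) (min L (x + r / 2)) ⊆ Icc 0 L :=
    Icc_subset_Icc (le_max_left _ _) (min_le_left _ _)
  refine ⟨max 0 (x - r / 2), min L (x + r / 2), a x / 2, ?_, by linarith, hsub, fun t ht => ?_⟩
  · have := hx.1
    have := hx.2
    exact max_lt (lt_min hL (by linarith)) (lt_min (by linarith) (by linarith))
  · have h₁ := (le_max_right _ _).trans ht.1
    have h₂ := ht.2.trans (min_le_right _ _)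
    have := hra (hsub ht) (by rw [Real.dist_eq, abs_lt]; constructor <;> linarith)
    rw [Real.dist_eq, abs_lt] at this
    linarith

/-- The substitution `z = u ^ (1 - q)`, `p = u' / u ^ q` turns `(P_N)` into a first order system
for `z` and `p`. This is the shooting argument solving the resulting boundary value problem. -/
theorem exists_solution_of_integral_neg {L : ℝ} (hL : 0 < L) {a : ℝ → ℝ}
    (ha : ContinuousOn a (Icc 0 L)) (hpos : ∃ x ∈ Icc (0 : ℝ) L, 0 < a x)
    (hint : (∫ x in (0 : ℝ)..L, a x) < 0) :
    ∃ ε : ℝ, 0 < ε ∧ ε < 1 ∧ ∃ z p : ℝ → ℝ, p 0 = 0 ∧ p L = 0 ∧ ∀ t ∈ Icc 0 L, 0 < z t ∧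
      HasDerivWithinAt z (ε * p t) (Icc 0 L) t ∧
      HasDerivWithinAt p (-a t - (1 - ε) * (p t ^ 2 / z t)) (Icc 0 L) t := by
  obtain ⟨x₀, hx₀, hax₀⟩ := hpos
  obtain ⟨c, d, η, hcd, hη, hsub, hηa⟩ := exists_Icc_le_of_pos hL ha hx₀ hax₀
  obtain ⟨A, hA⟩ := isCompact_Icc.exists_bound_of_continuousOn ha
  have h0 : (0 : ℝ) ∈ Icc 0 L := ⟨le_rfl, hL.le⟩
  have hLL : L ∈ Icc 0 L := ⟨hL.le, le_rfl⟩
  have hA0 : 0 ≤ A := (norm_nonneg _).trans (hA 0 h0)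
  set M := A * L with hMdef
  have hM : 0 ≤ M := by positivity
  obtain ⟨k, hk, hkd⟩ : ∃ k : ℝ, 0 < k ∧ η * k * (d - c) = 4 := by
    have : 0 < d - c := sub_pos.2 hcd
    exact ⟨4 / (η * (d - c)), by positivity, by field_simp⟩
  obtain ⟨s₀, hs₀, hs₀k⟩ : ∃ s₀ : ℝ, 0 < s₀ ∧ 4 * s₀ * (η * k ^ 2) = 1 :=
    ⟨1 / (4 * (η * k ^ 2)), by positivity, by field_simp⟩
  obtain ⟨ε, hε, hε2, hεM⟩ : ∃ ε : ℝ, 0 < ε ∧ ε ≤ 1 / 2 ∧ ε * M * L ≤ s₀ / 2 := by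
    refine ⟨s₀ / (2 * (s₀ + M * L)), by positivity, ?_, ?_⟩
    · rw [div_le_div_iff₀ (by positivity) (by positivity)]
      nlinarith [mul_nonneg hM hL.le]
    · rw [div_mul_eq_mul_div, div_mul_eq_mul_div, div_le_div_iff₀ (by positivity) (by positivity)]
      nlinarith
  set I := -∫ x in (0 : ℝ)..L, a x with hI
  have hI0 : 0 < I := by linarith
  obtain ⟨s₁, hs₀₁, hs₁I⟩ : ∃ s₁ : ℝ, s₀ ≤ s₁ ∧ 2 * M ^ 2 / s₁ * L < I := by
    refine ⟨s₀ + 2 * M ^ 2 * L / I, le_add_of_nonneg_right (by positivity), ?_⟩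
    rw [div_mul_eq_mul_div, div_lt_iff₀ (by positivity), mul_add, mul_div_cancel₀ _ hI0.ne']
    nlinarith
  obtain ⟨z, p, hzp, hcont⟩ := exists_truncated_flow hL.le ha (M := M) (ε := ε) (q := 1 - ε)
    (δ := s₀ / 2) hM (by positivity) s₀ s₁
  have hz : ∀ s ∈ Icc s₀ s₁, ∀ t ∈ Icc 0 L, |z s t - s| ≤ s₀ / 2 := by
    intro s hs t ht
    obtain ⟨hz0, -, hd⟩ := hzp s hs
    have hcl (x : ℝ) := abs_le.1 (abs_clamp_le hM (p s x))
    have h₁ := sub_le_mul_sub_of_hasDerivWithinAt_le (C := ε * M) (fun x hx => (hd x hx).1)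
      (fun x hx => by gcongr; exact (hcl x).2) h0 ht ht.1
    have h₂ := sub_le_mul_sub_of_hasDerivWithinAt_le (C := ε * M) (fun x hx => (hd x hx).1.neg)
      (fun x hx => by rw [← mul_neg]; gcongr; linarith [(hcl x).1]) h0 ht ht.1
    have h₃ : ε * M * t ≤ ε * M * L := by
      gcongr
      exact ht.2
    simp only [Pi.neg_apply] at h₂
    rw [abs_le]
    constructor <;> linarith
  have hmax : ∀ s ∈ Icc s₀ s₁, ∀ t ∈ Icc 0 L, max (z s t) (s₀ / 2) = z s t := by
    intro s hs t ht
    have := abs_le.1 (hz s hs t ht)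
    exact max_eq_left (by linarith [hs.1])
  have hzpos : ∀ s ∈ Icc s₀ s₁, ∀ t ∈ Icc 0 L, 0 < z s t := fun s hs t ht => by
    have := abs_le.1 (hz s hs t ht)
    linarith [hs.1]
  have hpM : ∀ s ∈ Icc s₀ s₁, 0 ≤ p s L → ∀ t ∈ Icc 0 L, |p s t| ≤ M := by
    intro s hs hpL t ht
    obtain ⟨-, hp0, hd⟩ := hzp s hs
    have hle : ∀ x ∈ Icc 0 L,
        -a x - (1 - ε) * (clamp M (p s x) ^ 2 / max (z s x) (s₀ / 2)) ≤ A := by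
      intro x hx
      rw [hmax s hs x hx]
      have h₁ := abs_le.1 (hA x hx)
      have h₂ : 0 ≤ (1 - ε) * (clamp M (p s x) ^ 2 / z s x) :=
        mul_nonneg (by linarith) (div_nonneg (sq_nonneg _) (hzpos s hs x hx).le)
      linarith
    have h₁ := sub_le_mul_sub_of_hasDerivWithinAt_le (fun x hx => (hd x hx).2) hle h0 ht ht.1
    have h₂ := sub_le_mul_sub_of_hasDerivWithinAt_le (fun x hx => (hd x hx).2) hle ht hLL ht.2
    rw [abs_le]
    constructor <;> nlinarith [ht.1, ht.2]
  have hleft : p s₀ L ≤ 0 := by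
    by_contra! hneg
    have hs : s₀ ∈ Icc s₀ s₁ := ⟨le_rfl, hs₀₁⟩
    have hlt := mul_length_lt_pi_of_riccati hcd.le hk.le (η := η)
      (fun x hx => ((hzp s₀ hs).2.2 x (hsub hx)).2.mono hsub) fun x hx => by
        have hzx := hz s₀ hs x (hsub hx)
        have hz0 := hzpos s₀ hs x (hsub hx)
        rw [hmax s₀ hs x (hsub hx), clamp_eq_self (hpM s₀ hs hneg.le x (hsub hx))]
        have h₁ : η * (k * p s₀ x) ^ 2 = 1 / 2 * (p s₀ x ^ 2 / (2 * s₀)) := by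
          field_simp
          linear_combination p s₀ x ^ 2 * hs₀k
        have h₂ : 1 / 2 * (p s₀ x ^ 2 / (2 * s₀)) ≤ (1 - ε) * (p s₀ x ^ 2 / z s₀ x) := by
          have h₃ : 1 / 2 ≤ 1 - ε := by linarith
          have h₄ : z s₀ x ≤ 2 * s₀ := by linarith [(abs_le.1 hzx).2]
          gcongr
        linarith [hηa x hx]
    linarith [pi_le_four]
  have hright : 0 ≤ p s₁ L := by
    have hs : s₁ ∈ Icc s₀ s₁ := ⟨hs₀₁, le_rfl⟩
    obtain ⟨-, hp0, hd⟩ := hzp s₁ hs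
    have hai : IntervalIntegrable a MeasureTheory.volume 0 L :=
      ha.intervalIntegrable_of_Icc hL.le
    have h := intervalIntegral.integral_le_sub_of_hasDeriv_right_of_le
      (φ := fun x => -a x - 2 * M ^ 2 / s₁) hL.le
      (HasDerivWithinAt.continuousOn fun x hx => (hd x hx).2)
      (fun x hx => ((hd x (Ioo_subset_Icc_self hx)).2.hasDerivAt
        (Icc_mem_nhds hx.1 hx.2)).hasDerivWithinAt)
      ((ha.neg.sub continuousOn_const).integrableOn_Icc) (fun x hx => by
        have hx' := Ioo_subset_Icc_self hx
        have hzx := abs_le.1 (hz s₁ hs x hx')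
        have hz0 := hzpos s₁ hs x hx'
        have hs₁ : 0 < s₁ := by linarith
        rw [hmax s₁ hs x hx']
        have h₁ : (1 - ε) * (clamp M (p s₁ x) ^ 2 / z s₁ x) ≤ 1 * (M ^ 2 / (s₁ / 2)) := by
          have h₂ : 1 - ε ≤ 1 := by linarith
          have h₃ := abs_le.1 (abs_clamp_le hM (p s₁ x))
          have h₄ := sq_le_sq' h₃.1 h₃.2
          have h₅ : s₁ / 2 ≤ z s₁ x := by linarith
          gcongr
        have h₂ : M ^ 2 / (s₁ / 2) = 2 * M ^ 2 / s₁ := by field_simp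
        linarith)
    rw [intervalIntegral.integral_sub (f := fun x => -a x) hai.neg intervalIntegrable_const,
      intervalIntegral.integral_neg, intervalIntegral.integral_const, hp0, smul_eq_mul] at h
    linarith
  obtain ⟨s, hs, hsL⟩ := intermediate_value_Icc hs₀₁ hcont ⟨hleft, hright⟩
  obtain ⟨-, hp0, hd⟩ := hzp s hs
  refine ⟨ε, hε, by linarith, z s, p s, hp0, hsL, fun t ht => ⟨hzpos s hs t ht, ?_⟩⟩
  have := hd t ht
  rwa [hmax s hs t ht, clamp_eq_self (hpM s hs hsL.ge t ht)] at this

theorem integral_neg_of_neumannSolution {L q : ℝ} (hL : 0 < L) (hq : 0 < q) {a u u' u'' : ℝ → ℝ}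
    (ha : ContinuousOn a (Icc 0 L)) (hne : ∃ x ∈ Icc (0 : ℝ) L, a x ≠ 0)
    (h : NeumannSolution L q a u u' u'') (hpos : ∀ x ∈ Icc (0 : ℝ) L, 0 < u x) :
    (∫ x in (0 : ℝ)..L, a x) < 0 := by
  obtain ⟨hu, hu', -, -, h0, hL0, heq⟩ := h
  have huc : ContinuousOn u (Icc 0 L) := HasDerivWithinAt.continuousOn hu
  have hu'c : ContinuousOn u' (Icc 0 L) := HasDerivWithinAt.continuousOn hu'
  set g : ℝ → ℝ := fun x => q * (u' x ^ 2 * u x ^ (-q - 1)) with hg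
  have hgc : ContinuousOn g (Icc 0 L) := continuousOn_const.mul ((hu'c.pow 2).mul
    (huc.rpow_const fun x hx => .inl (hpos x hx).ne'))
  have hP : ∀ x ∈ Icc 0 L,
      HasDerivWithinAt (fun x => u' x * u x ^ (-q)) (-(a x + g x)) (Icc 0 L) x := by
    intro x hx
    have hux := hpos x hx
    refine ((hu' x hx).mul ((hu x hx).rpow_const (p := -q) (.inl hux.ne'))).congr_deriv ?_
    have h₁ : u'' x = -(a x * u x ^ q) := by linarith [heq x hx]
    have h₂ : u x ^ q * u x ^ (-q) = 1 := by rw [← rpow_add hux]; simp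
    rw [h₁, hg]
    linear_combination -a x * h₂
  have hFTC := intervalIntegral.integral_eq_sub_of_hasDerivAt_of_le hL.le
    (HasDerivWithinAt.continuousOn hP)
    (fun x hx => (hP x (Ioo_subset_Icc_self hx)).hasDerivAt (Icc_mem_nhds hx.1 hx.2))
    ((ha.add hgc).neg.intervalIntegrable_of_Icc hL.le)
  rw [intervalIntegral.integral_neg, intervalIntegral.integral_add
    (ha.intervalIntegrable_of_Icc hL.le) (hgc.intervalIntegrable_of_Icc hL.le), h0, hL0] at hFTC
  have hex : ∃ c ∈ Icc 0 L, u' c ≠ 0 := by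
    by_contra! hc
    obtain ⟨x, hx, hax⟩ := hne
    have hzero : HasDerivWithinAt u' 0 (Icc 0 L) x :=
      (hasDerivWithinAt_const x _ (0 : ℝ)).congr hc (hc x hx)
    have h₁ : u'' x = 0 := ((uniqueDiffOn_Icc hL) x hx).eq_deriv _ (hu' x hx) hzero
    have h₂ := heq x hx
    rw [h₁, neg_zero] at h₂
    exact mul_ne_zero hax (rpow_pos_of_pos (hpos x hx) q).ne' h₂.symm
  obtain ⟨c, hc, hu'0⟩ := hex
  have hgpos : 0 < ∫ x in (0 : ℝ)..L, g x := by
    refine intervalIntegral.integral_pos hL hgc (fun x hx => ?_) ⟨c, hc, ?_⟩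
    · have := hpos x (Ioc_subset_Icc_self hx)
      positivity
    · have := hpos c hc
      positivity
  linarith

/-- One-dimensional characterization: for a sign-changing continuous weight `a`, there
exists some `q ∈ (0,1)` for which the Neumann problem has a strongly positive solution
if and only if `∫₀^L a < 0` (condition (A.0)). -/
theorem stmt_19 (L : ℝ) (hL : 0 < L)
    (a : ℝ → ℝ) (ha : ContinuousOn a (Set.Icc 0 L)) (hsign : ChangesSign L a) :
    (∃ q : ℝ, 0 < q ∧ q < 1 ∧
      ∃ u u' u'' : ℝ → ℝ, NeumannSolution L q a u u' u'' ∧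
        ∀ x ∈ Set.Icc (0 : ℝ) L, 0 < u x) ↔
    (∫ x in (0 : ℝ)..L, a x) < 0 := by
  constructor
  · rintro ⟨q, hq, -, u, u', u'', h, hpos⟩
    obtain ⟨x, hx, hax⟩ := hsign.1
    exact integral_neg_of_neumannSolution hL hq ha ⟨x, hx, hax.ne'⟩ h hpos
  · intro hint
    obtain ⟨ε, hε, hε1, z, p, hp0, hpL, h⟩ := exists_solution_of_integral_neg hL ha hsign.1 hint
    have hzc : ContinuousOn z (Icc 0 L) := HasDerivWithinAt.continuousOn fun x hx => (h x hx).2.1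
    have hupos : ∀ x ∈ Icc 0 L, 0 < z x ^ (1 / ε) := fun x hx => rpow_pos_of_pos (h x hx).1 _
    refine ⟨1 - ε, by linarith, by linarith, fun x => z x ^ (1 / ε),
      fun x => p x * z x ^ (1 / ε - 1), fun x => -(a x * z x ^ (1 / ε - 1)),
      ⟨fun x hx => ?_, fun x hx => ?_, ?_, fun x hx => (hupos x hx).le, by simp [hp0],
        by simp [hpL], fun x hx => ?_⟩, hupos⟩
    · refine ((h x hx).2.1.rpow_const (.inl (h x hx).1.ne')).congr_deriv ?_
      field_simp
    · have hz := (h x hx).1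
      refine ((h x hx).2.2.mul ((h x hx).2.1.rpow_const (p := 1 / ε - 1)
        (.inl hz.ne'))).congr_deriv ?_
      rw [rpow_sub_one hz.ne' (1 / ε - 1)]
      field_simp
      ring
    · exact (ha.mul (hzc.rpow_const fun x hx => .inl (h x hx).1.ne')).neg
    · rw [neg_neg, ← rpow_mul (h x hx).1.le]
      congr 2
      field_simp
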